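/- arXiv:1802.09747 — 2 statements merged into one kernel-verified Lean document; each statement's English description precedes it below -/
import Mathlib

section
/- Under the AAGD dynamics, suppose additionally that h is strongly convex with modulus μ where 0 < μ ≤ L, that the step size satisfies (5/2)γL + γL(τ² + 3τ)² ≤ 1, and that θ^k is the constant θ ∈ (0,1) given by the positive root of θ² + γμθ − γμ = 0, i.e. θ = (−γμ + √(γ²μ² + 4γμ))/2. Then for every K ≥ 0, F(x^{K+1}) − F(x^*) ≤ (1 − θ)^{K+1} · [ F(x^0) − F(x^*) + (θ²/(2γ) + μθ/2) · ‖z^0 − x^*‖² ]. -/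
open scoped RealInnerProductSpace

section
variable {H : Type*} [NormedAddCommGroup H] [InnerProductSpace ℝ H]

theorem HasGradientAt.hasDerivAt_add_smul [CompleteSpace H] {f : H → ℝ} {f' : H → H}
    (hf : ∀ u, HasGradientAt f (f' u) u) (u d : H) (t : ℝ) :
    HasDerivAt (fun s : ℝ => f (u + s • d)) ⟪f' (u + t • d), d⟫ t := by
  have h1 : HasDerivAt (fun s : ℝ => u + s • d) d t := by
    simpa using ((hasDerivAt_id t).smul_const d).const_add u
  have h2 := (hf (u + t • d)).hasFDerivAt.comp_hasDerivAt t h1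
  rwa [InnerProductSpace.toDual_apply_apply] at h2

theorem ConvexOn.add_inner_gradient_le [CompleteSpace H] {f : H → ℝ} {f' : H → H}
    (hconv : ConvexOn ℝ Set.univ f) (hf : ∀ u, HasGradientAt f (f' u) u) (u v : H) :
    f u + ⟪f' u, v - u⟫ ≤ f v := by
  have hd := HasGradientAt.hasDerivAt_add_smul hf u (v - u) 0
  have hc : ConvexOn ℝ Set.univ (fun s : ℝ => f (u + s • (v - u))) := by
    refine ⟨convex_univ, fun s _ t _ a b ha hb hab => ?_⟩
    have := hconv.2 (Set.mem_univ (u + s • (v - u))) (Set.mem_univ (u + t • (v - u))) ha hb hab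
    convert this using 2
    obtain rfl : b = 1 - a := by linarith
    simp only [smul_eq_mul]
    module
  have := hc.le_slope_of_hasDerivAt (Set.mem_univ 0) (Set.mem_univ 1) one_pos hd
  simp [slope_def_field] at this
  linarith

/-- The descent lemma. -/
theorem le_add_inner_gradient_of_lipschitz [CompleteSpace H] {f : H → ℝ} {f' : H → H} {L : ℝ}
    (hf : ∀ u, HasGradientAt f (f' u) u) (hlip : ∀ u v, ‖f' u - f' v‖ ≤ L * ‖u - v‖) (u v : H) :
    f v ≤ f u + ⟪f' u, v - u⟫ + L / 2 * ‖v - u‖ ^ 2 := by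
  set d := v - u with hd
  have hder (t : ℝ) : HasDerivAt
      (fun s : ℝ => f (u + s • d) - (s * ⟪f' u, d⟫ + s ^ 2 * (L / 2 * ‖d‖ ^ 2)))
      (⟪f' (u + t • d), d⟫ - (⟪f' u, d⟫ + 2 * t * (L / 2 * ‖d‖ ^ 2))) t := by
    refine (HasGradientAt.hasDerivAt_add_smul hf u d t).sub (HasDerivAt.add ?_ ?_)
    · simpa using (hasDerivAt_id t).mul_const ⟪f' u, d⟫
    · simpa using (hasDerivAt_pow 2 t).mul_const (L / 2 * ‖d‖ ^ 2)
  have hanti := antitoneOn_of_deriv_nonpos (convex_Icc (0 : ℝ) 1)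
    (fun t _ => (hder t).continuousAt.continuousWithinAt)
    (fun t _ => (hder t).differentiableAt.differentiableWithinAt) (fun t ht => by
      rw [interior_Icc] at ht
      rw [(hder t).deriv]
      have h1 : ⟪f' (u + t • d), d⟫ - ⟪f' u, d⟫ ≤ L * (t * ‖d‖) * ‖d‖ := by
        rw [← inner_sub_left]
        refine (real_inner_le_norm _ _).trans ?_
        gcongr
        simpa [norm_smul, abs_of_pos ht.1] using hlip (u + t • d) u
      linarith)
  have := hanti (Set.left_mem_Icc.2 zero_le_one) (Set.right_mem_Icc.2 zero_le_one) zero_le_one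
  simp [hd] at this
  linarith

/-- Quadratic growth of a proximal objective around its minimizer. -/
theorem StrongConvexOn.prox_add_sq_le {h : H → ℝ} {μ c : ℝ} (hμ : 0 ≤ μ) (hc : 0 ≤ c)
    (hh : StrongConvexOn Set.univ μ h) {g z p : H}
    (hp : ∀ u, h p + ⟪g, p - z⟫ + c * ‖p - z‖ ^ 2 ≤ h u + ⟪g, u - z⟫ + c * ‖u - z‖ ^ 2) (u : H) :
    h p + ⟪g, p - z⟫ + c * ‖p - z‖ ^ 2 + (μ / 2 + c) * ‖p - u‖ ^ 2
      ≤ h u + ⟪g, u - z⟫ + c * ‖u - z‖ ^ 2 := by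
  set M := (μ / 2 + c) * ‖p - u‖ ^ 2 with hM
  have hM0 : 0 ≤ M := by positivity
  set C := h p + ⟪g, p - z⟫ + c * ‖p - z‖ ^ 2 + M - (h u + ⟪g, u - z⟫ + c * ‖u - z‖ ^ 2) with hC
  by_contra! hlt
  have hC0 : 0 < C := by linarith
  have hCM : C ≤ M := by linarith [hp u]
  have key (t : ℝ) (ht0 : 0 < t) (ht1 : t ≤ 1) : C ≤ t * M := by
    have h1 := hh.2 (Set.mem_univ p) (Set.mem_univ u) (sub_nonneg.2 ht1) ht0.le (by ring)
    have h2 := hp ((1 - t) • p + t • u)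
    have e1 : (1 - t) • p + t • u - z = (1 - t) • (p - z) + t • (u - z) := by module
    have e2 : p - u = (p - z) - (u - z) := by abel
    have e3 : ‖(1 - t) • (p - z) + t • (u - z)‖ ^ 2
        = (1 - t) * ‖p - z‖ ^ 2 + t * ‖u - z‖ ^ 2 - t * (1 - t) * ‖p - u‖ ^ 2 := by
      rw [e2, norm_add_sq_real, norm_sub_sq_real (p - z)]
      simp only [norm_smul, inner_smul_left, inner_smul_right, mul_pow, Real.norm_eq_abs, sq_abs,
        conj_trivial]
      ring
    rw [e1, e3, inner_add_right, inner_smul_right, inner_smul_right] at h2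
    simp only [smul_eq_mul] at h1
    refine le_of_mul_le_mul_left ?_ ht0
    rw [hC, hM]
    linear_combination h2 + h1
  have hMp : 0 < M := hC0.trans_le hCM
  have := key (C / (2 * M)) (by positivity) (by rw [div_le_one (by positivity)]; linarith)
  have e : C / (2 * M) * M = C / 2 := by field_simp
  linarith

/-- If `y k` extrapolates `x k` with momentum factor `q`, then restarting the unperturbed momentum
recursion at index `m` predicts `y (m + n)` up to the accumulated corrections
`x (i + 1) - y i`, `m ≤ i < m + n`. -/
theorem norm_sub_momentum_prediction_le {q : ℝ} (hq0 : 0 ≤ q) (hq1 : q ≤ 1) {x y : ℕ → H}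
    (hy : ∀ k, y k = x k + q • (x k - x (k - 1))) (m n : ℕ) :
    ‖y (m + n) - (x m + (∑ i ∈ Finset.range (n + 1), q ^ (i + 1)) • (x m - x (m - 1)))‖
      ≤ ∑ r ∈ Finset.range n, ((r : ℝ) + 2) * ‖x (m + n - 1 - r + 1) - y (m + n - 1 - r)‖ := by
  set e : ℕ → H := fun i => x (i + 1) - y i with he
  have hD (n : ℕ) : ‖(x (m + n) - x (m + n - 1)) - q ^ n • (x m - x (m - 1))‖
      ≤ ∑ s ∈ Finset.range n, ‖e (m + s)‖ := by
    induction n with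
    | zero => simp
    | succ n ih =>
      have : (x (m + (n + 1)) - x (m + (n + 1) - 1)) - q ^ (n + 1) • (x m - x (m - 1))
          = q • ((x (m + n) - x (m + n - 1)) - q ^ n • (x m - x (m - 1))) + e (m + n) := by
        simp only [he, hy (m + n), ← add_assoc, Nat.add_sub_cancel]
        module
      rw [this, Finset.sum_range_succ]
      refine (norm_add_le _ _).trans (add_le_add_left ?_ _)
      rw [norm_smul, Real.norm_of_nonneg hq0]
      exact (mul_le_of_le_one_left (norm_nonneg _) hq1).trans ih
  have hY (n : ℕ) :
      ‖y (m + n) - (x m + (∑ i ∈ Finset.range (n + 1), q ^ (i + 1)) • (x m - x (m - 1)))‖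
        ≤ ∑ s ∈ Finset.range n, ((n : ℝ) - s + 1) * ‖e (m + s)‖ := by
    induction n with
    | zero => simp [hy m]
    | succ n ih =>
      have : y (m + (n + 1))
            - (x m + (∑ i ∈ Finset.range (n + 1 + 1), q ^ (i + 1)) • (x m - x (m - 1)))
          = (y (m + n) - (x m + (∑ i ∈ Finset.range (n + 1), q ^ (i + 1)) • (x m - x (m - 1))))
            + e (m + n)
            + q • ((x (m + (n + 1)) - x (m + (n + 1) - 1)) - q ^ (n + 1) • (x m - x (m - 1))) := by
        rw [Finset.sum_range_succ _ (n + 1), hy (m + (n + 1))]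
        simp only [he, ← add_assoc, Nat.add_sub_cancel]
        module
      rw [this]
      refine norm_add₃_le.trans ?_
      have hD' := hD (n + 1)
      have h3 : ‖q • ((x (m + (n + 1)) - x (m + (n + 1) - 1)) - q ^ (n + 1) • (x m - x (m - 1)))‖
          ≤ ∑ s ∈ Finset.range (n + 1), ‖e (m + s)‖ := by
        rw [norm_smul, Real.norm_of_nonneg hq0]
        exact (mul_le_of_le_one_left (norm_nonneg _) hq1).trans hD'
      have h4 : ∑ s ∈ Finset.range (n + 1), (((n + 1 : ℕ) : ℝ) - s + 1) * ‖e (m + s)‖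
          = ∑ s ∈ Finset.range n, ((n : ℝ) - s + 1) * ‖e (m + s)‖ + ‖e (m + n)‖
            + ∑ s ∈ Finset.range (n + 1), ‖e (m + s)‖ := by
        rw [Finset.sum_range_succ, Finset.sum_range_succ (fun s => ‖e (m + s)‖),
          show ∑ s ∈ Finset.range n, (((n + 1 : ℕ) : ℝ) - s + 1) * ‖e (m + s)‖
            = ∑ s ∈ Finset.range n, ((n : ℝ) - s + 1) * ‖e (m + s)‖
              + ∑ s ∈ Finset.range n, ‖e (m + s)‖ by
            rw [← Finset.sum_add_distrib]
            refine Finset.sum_congr rfl fun s _ => ?_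
            push_cast
            ring]
        push_cast
        ring
      linarith
  refine (hY n).trans_eq ?_
  rw [← Finset.sum_range_reflect]
  refine Finset.sum_congr rfl fun r hr => ?_
  have hr := Finset.mem_range.1 hr
  have e1 : ((n - 1 - r : ℕ) : ℝ) = n - 1 - r := by
    rw [Nat.sub_sub, Nat.cast_sub (by omega)]; push_cast; ring
  rw [e1, show m + (n - 1 - r) = m + n - 1 - r by omega]
  simp only [he]
  ring

end

theorem sum_range_add_two (n : ℕ) :
    ∑ r ∈ Finset.range n, ((r : ℝ) + 2) = ((n : ℝ) ^ 2 + 3 * n) / 2 := by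
  induction n with
  | zero => simp
  | succ n ih => rw [Finset.sum_range_succ, ih]; push_cast; ring

theorem sum_range_shift_le {A : ℕ → ℝ} (hA : ∀ k, 0 ≤ A k) (r N : ℕ) :
    ∑ k ∈ Finset.range N, (if r < k then A (k - 1 - r) else 0) ≤ ∑ k ∈ Finset.range N, A k := by
  rw [← Finset.sum_filter]
  rw [← Finset.sum_image (g := fun k => k - 1 - r) (f := A)]
  · refine Finset.sum_le_sum_of_subset_of_nonneg (fun k hk => ?_) fun k _ _ => hA k
    simp only [Finset.mem_image, Finset.mem_filter, Finset.mem_range] at hk ⊢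
    omega
  · intro k hk l hl hkl
    simp only [Finset.coe_filter, Set.mem_ofPred_eq] at hk hl hkl
    omega

/-- Weighted `ℓ²` bound for a delayed sum with linearly growing coefficients. -/
theorem sum_pow_mul_sq_delayed_le {p : ℝ} (hp0 : 0 ≤ p) {τ : ℕ} (hp : ∀ r ≤ τ, p ^ r ≤ 2)
    {D E : ℕ → ℝ} (hD0 : ∀ k, 0 ≤ D k) {n : ℕ → ℕ} (hnτ : ∀ k, n k ≤ τ) (hnk : ∀ k, n k ≤ k)
    (hD : ∀ k, D k ≤ ∑ r ∈ Finset.range (n k), ((r : ℝ) + 2) * E (k - 1 - r)) (N : ℕ) :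
    ∑ k ∈ Finset.range N, p ^ (k + 1) * D k ^ 2
      ≤ ((τ : ℝ) ^ 2 + 3 * τ) ^ 2 / 2 * ∑ k ∈ Finset.range N, p ^ (k + 1) * E k ^ 2 := by
  set S : ℝ := ((τ : ℝ) ^ 2 + 3 * τ) / 2 with hS
  have hS0 : 0 ≤ S := by positivity
  set A : ℕ → ℝ := fun k => p ^ (k + 1) * E k ^ 2 with hA
  have hA0 (k : ℕ) : 0 ≤ A k := by positivity
  have hk (k : ℕ) : p ^ (k + 1) * D k ^ 2 ≤ 2 * S * ∑ r ∈ Finset.range τ,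
      ((r : ℝ) + 2) * (if r < k then A (k - 1 - r) else 0) := by
    have hcs : D k ^ 2 ≤ (∑ r ∈ Finset.range (n k), ((r : ℝ) + 2))
        * ∑ r ∈ Finset.range (n k), ((r : ℝ) + 2) * E (k - 1 - r) ^ 2 :=
      (pow_le_pow_left₀ (hD0 k) (hD k) 2).trans
        (Finset.sum_sq_le_sum_mul_sum_of_sq_le_mul _ (fun r _ => by positivity)
          (fun r _ => by positivity) (fun r _ => le_of_eq (by ring)))
    have hS' : ∑ r ∈ Finset.range (n k), ((r : ℝ) + 2) ≤ S := by
      rw [sum_range_add_two, hS]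
      have : (n k : ℝ) ≤ τ := by exact_mod_cast hnτ k
      gcongr
    calc p ^ (k + 1) * D k ^ 2
        ≤ p ^ (k + 1) * (S * ∑ r ∈ Finset.range (n k), ((r : ℝ) + 2) * E (k - 1 - r) ^ 2) := by
          refine mul_le_mul_of_nonneg_left (hcs.trans ?_) (by positivity)
          exact mul_le_mul_of_nonneg_right hS' (Finset.sum_nonneg fun r _ => by positivity)
      _ = S * ∑ r ∈ Finset.range (n k), p ^ (k + 1) * (((r : ℝ) + 2) * E (k - 1 - r) ^ 2) := by
          rw [← Finset.mul_sum]; ring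
      _ ≤ S * ∑ r ∈ Finset.range (n k),
            2 * (((r : ℝ) + 2) * (if r < k then A (k - 1 - r) else 0)) := by
          refine mul_le_mul_of_nonneg_left (Finset.sum_le_sum fun r hr => ?_) hS0
          have hr := Finset.mem_range.1 hr
          have hrk : r < k := hr.trans_le (hnk k)
          rw [if_pos hrk, show k + 1 = (k - 1 - r + 1) + (r + 1) by omega, pow_add]
          have h2 := mul_le_mul_of_nonneg_left (hp (r + 1) (hr.trans_le (hnτ k)))
            (mul_nonneg (by positivity : (0 : ℝ) ≤ (r : ℝ) + 2) (hA0 (k - 1 - r)))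
          simp only [hA] at h2 ⊢
          linarith
      _ ≤ S * ∑ r ∈ Finset.range τ,
            2 * (((r : ℝ) + 2) * (if r < k then A (k - 1 - r) else 0)) := by
          refine mul_le_mul_of_nonneg_left (Finset.sum_le_sum_of_subset_of_nonneg
            (Finset.range_mono (hnτ k)) fun r _ _ => ?_) hS0
          split_ifs
          · have := hA0 (k - 1 - r)
            positivity
          · simp
      _ = _ := by rw [← Finset.mul_sum]; ring
  calc ∑ k ∈ Finset.range N, p ^ (k + 1) * D k ^ 2
      ≤ ∑ k ∈ Finset.range N, 2 * S * ∑ r ∈ Finset.range τ,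
          ((r : ℝ) + 2) * (if r < k then A (k - 1 - r) else 0) :=
        Finset.sum_le_sum fun k _ => hk k
    _ = 2 * S * ∑ r ∈ Finset.range τ, ((r : ℝ) + 2) *
          ∑ k ∈ Finset.range N, (if r < k then A (k - 1 - r) else 0) := by
        rw [← Finset.mul_sum, Finset.sum_comm]
        simp_rw [Finset.mul_sum]
    _ ≤ 2 * S * ∑ r ∈ Finset.range τ, ((r : ℝ) + 2) * ∑ k ∈ Finset.range N, A k := by
        refine mul_le_mul_of_nonneg_left (Finset.sum_le_sum fun r _ => ?_) (by positivity)
        exact mul_le_mul_of_nonneg_left (sum_range_shift_le hA0 r N) (by positivity)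
    _ = _ := by
        rw [← Finset.sum_mul, sum_range_add_two, hS]
        ring

theorem half_le_one_sub_pow {θ : ℝ} {τ r : ℕ} (hθ0 : 0 ≤ θ) (hθ1 : θ ≤ 1) (hθτ : θ * τ ≤ 1 / 2)
    (hr : r ≤ τ) : 1 / 2 ≤ (1 - θ) ^ r := by
  have h1 := one_add_mul_le_pow (a := -θ) (by linarith) r
  have h2 : θ * r ≤ θ * τ := by gcongr
  rw [← sub_eq_add_neg] at h1
  linarith

/-- One step of the accelerated proximal gradient method with gradient evaluated at `w`. -/
theorem accelerated_prox_step_le {H : Type*} [NormedAddCommGroup H] [InnerProductSpace ℝ H]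
    [CompleteSpace H] {f h : H → ℝ} {f' : H → H} {L μ γ θ : ℝ} (hL : 0 ≤ L) (hμ : 0 ≤ μ)
    (hγ : 0 < γ) (hθ0 : 0 ≤ θ) (hθ1 : θ ≤ 1) (hf_conv : ConvexOn ℝ Set.univ f)
    (hf_grad : ∀ u, HasGradientAt f (f' u) u) (hf_lip : ∀ u v, ‖f' u - f' v‖ ≤ L * ‖u - v‖)
    (hh_conv : ConvexOn ℝ Set.univ h) (hh_sc : StrongConvexOn Set.univ μ h)
    {x x' y z z' w : H} (s : H) (hy : y = (1 - θ) • x + θ • z)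
    (hz : ∀ u, h z' + ⟪f' w, z' - z⟫ + θ / (2 * γ) * ‖z' - z‖ ^ 2
      ≤ h u + ⟪f' w, u - z⟫ + θ / (2 * γ) * ‖u - z‖ ^ 2)
    (hx : x' = θ • z' + (1 - θ) • x) :
    f x' + h x' - (f s + h s) + (θ ^ 2 / (2 * γ) + μ * θ / 2) * ‖z' - s‖ ^ 2
      ≤ (1 - θ) * (f x + h x - (f s + h s)) + θ ^ 2 / (2 * γ) * ‖z - s‖ ^ 2
        + (L * ‖y - w‖ ^ 2 - (1 / (2 * γ) - L) * ‖x' - y‖ ^ 2) := by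
  have hdesc := le_add_inner_gradient_of_lipschitz hf_grad hf_lip w x'
  have hcx := mul_le_mul_of_nonneg_left (hf_conv.add_inner_gradient_le hf_grad w x)
    (sub_nonneg.2 hθ1)
  have hcs := mul_le_mul_of_nonneg_left (hf_conv.add_inner_gradient_le hf_grad w s) hθ0
  have hh := hh_conv.2 (Set.mem_univ z') (Set.mem_univ x) hθ0 (sub_nonneg.2 hθ1) (by ring)
  rw [← hx] at hh
  simp only [smul_eq_mul] at hh
  have hprox := mul_le_mul_of_nonneg_left (hh_sc.prox_add_sq_le hμ (by positivity) hz s) hθ0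
  have hin : ⟪f' w, x' - w⟫ = (1 - θ) * ⟪f' w, x - w⟫ + θ * ⟪f' w, s - w⟫
      + θ * (⟪f' w, z' - z⟫ - ⟪f' w, s - z⟫) := by
    rw [← inner_sub_right, ← inner_smul_right, ← inner_smul_right, ← inner_smul_right,
      ← inner_add_right, ← inner_add_right, hx]
    congr 1
    module
  have hstep : x' - y = θ • (z' - z) := by rw [hx, hy]; module
  have hnorm : ‖x' - y‖ ^ 2 = θ ^ 2 * ‖z' - z‖ ^ 2 := by
    rw [hstep, norm_smul, mul_pow, Real.norm_eq_abs, sq_abs]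
  have htri : ‖x' - w‖ ^ 2 ≤ 2 * (‖x' - y‖ ^ 2 + ‖y - w‖ ^ 2) := by
    have := norm_sub_le_norm_sub_add_norm_sub x' y w
    exact (pow_le_pow_left₀ (norm_nonneg _) this 2).trans add_sq_le
  have htri' := mul_le_mul_of_nonneg_left htri (by positivity : 0 ≤ L / 2)
  rw [norm_sub_rev s z] at hprox
  have e1 : θ ^ 2 / (2 * γ) = θ * (θ / (2 * γ)) := by ring
  have e2 : 1 / (2 * γ) * ‖x' - y‖ ^ 2 = θ * (θ / (2 * γ) * ‖z' - z‖ ^ 2) := by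
    rw [hnorm]; ring
  rw [e1]
  linear_combination hdesc + hcx + hcs + hh + hprox + htri' + hin + e2

theorem momentum_coeff_eq {θ : ℝ} (hθ : θ ≠ 0) {a : ℕ → ℝ} {b : ℕ → ℕ → ℝ}
    (ha : ∀ k, 1 ≤ k → a k = θ * (1 - θ) / θ)
    (hb : ∀ l k, b l k = ∏ i ∈ Finset.Icc l k, a i) {m : ℕ} (hm : 1 ≤ m) (n : ℕ) :
    ∑ i ∈ Finset.Icc m (m + n), b m i = ∑ i ∈ Finset.range (n + 1), (1 - θ) ^ (i + 1) := by
  rw [← Finset.Ico_succ_right_eq_Icc, Finset.sum_Ico_eq_sum_range]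
  refine Finset.sum_congr (by congr 1; simp; omega) fun i _ => ?_
  rw [hb, Finset.prod_congr rfl (g := fun _ => 1 - θ) fun k hk => ?_]
  · simp; congr 1; omega
  · rw [ha k (hm.trans (Finset.mem_Icc.1 hk).1)]
    field_simp

/-- AAGD with momentum compensation, strongly convex case: if `h` is `μ`-strongly convex
with `0 < μ ≤ L`, the step size satisfies `(5/2)γL + γL(τ²+3τ)² ≤ 1`, and
`θ = (−γμ + √(γ²μ² + 4γμ))/2` is the positive root of `θ² + γμθ − γμ = 0`, then
`F(x^{K+1}) − F(x^*) ≤ (1−θ)^{K+1} [F(x^0) − F(x^*) + (θ²/(2γ) + μθ/2)‖z^0 − x^*‖²]`. -/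
theorem aagd_strongly_convex
    {H : Type*} [NormedAddCommGroup H] [InnerProductSpace ℝ H] [CompleteSpace H]
    (f h : H → ℝ) (f' : H → H) (L : ℝ) (hL : 0 < L)
    (hf_conv : ConvexOn ℝ Set.univ f)
    (hf_grad : ∀ u, HasGradientAt f (f' u) u)
    (hf_lip : ∀ u v, ‖f' u - f' v‖ ≤ L * ‖u - v‖)
    (hh_conv : ConvexOn ℝ Set.univ h)
    (μ : ℝ) (hμ : 0 < μ) (hμL : μ ≤ L)
    (hh_sc : StrongConvexOn Set.univ μ h)
    (xstar : H) (hmin : ∀ u, f xstar + h xstar ≤ f u + h u)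
    (γ : ℝ) (hγ : 0 < γ)
    (τ : ℕ) (hτ : 1 ≤ τ)
    (j : ℕ → ℕ) (hj : ∀ k, k - τ ≤ j k ∧ j k ≤ k)
    (θc : ℝ) (hθc : θc = (-(γ * μ) + Real.sqrt (γ ^ 2 * μ ^ 2 + 4 * γ * μ)) / 2)
    (θ a : ℕ → ℝ) (b : ℕ → ℕ → ℝ)
    (hθ : ∀ k, θ k = θc)
    (hθ_range : ∀ k, 0 < θ k ∧ θ k ≤ 1)
    (ha0 : a 0 = 0)
    (ha : ∀ k, 1 ≤ k → a k = θ k * (1 - θ (k - 1)) / θ (k - 1))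
    (hb : ∀ l k, b l k = ∏ i ∈ Finset.Icc l k, a i)
    (x z y w : ℕ → H)
    (hx0 : x 0 = z 0)
    (hy : ∀ k, y k = (1 - θ k) • x k + θ k • z k)
    (hw : ∀ k, w k = x (j k)
        + (∑ i ∈ Finset.Icc (j k) k, b (j k) i) • (x (j k) - x (j k - 1)))
    (hz : ∀ k, ∀ u : H,
      h (z (k + 1)) + ⟪f' (w k), z (k + 1) - z k⟫
          + θ k / (2 * γ) * ‖z (k + 1) - z k‖ ^ 2
        ≤ h u + ⟪f' (w k), u - z k⟫ + θ k / (2 * γ) * ‖u - z k‖ ^ 2)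
    (hx : ∀ k, x (k + 1) = θ k • z (k + 1) + (1 - θ k) • x k)
    (hstep : 5 / 2 * γ * L + γ * L * ((τ : ℝ) ^ 2 + 3 * τ) ^ 2 ≤ 1) :
    ∀ K : ℕ, (f (x (K + 1)) + h (x (K + 1))) - (f xstar + h xstar)
      ≤ (1 - θc) ^ (K + 1)
          * ((f (x 0) + h (x 0)) - (f xstar + h xstar)
            + (θc ^ 2 / (2 * γ) + μ * θc / 2) * ‖z 0 - xstar‖ ^ 2) := by
  have hγμ : 0 < γ * μ := mul_pos hγ hμ
  have hγL : 0 < γ * L := mul_pos hγ hL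
  obtain ⟨hθ0, hθ1⟩ : 0 < θc ∧ θc ≤ 1 := hθ 0 ▸ hθ_range 0
  have hroot : θc ^ 2 + γ * μ * θc - γ * μ = 0 := by
    have h1 := Real.sq_sqrt (by positivity : 0 ≤ γ ^ 2 * μ ^ 2 + 4 * γ * μ)
    rw [hθc]
    linear_combination h1 / 4
  set q := 1 - θc with hq
  have hq0 : 0 < q := by
    refine sub_pos.2 (lt_of_le_of_ne hθ1 fun h1 => ?_)
    rw [h1] at hroot
    linarith
  have hτ1 : (1 : ℝ) ≤ τ := by exact_mod_cast hτ
  have hθτ : θc * τ ≤ 1 / 2 := by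
    refine (pow_le_pow_iff_left₀ (by positivity) (by norm_num) two_ne_zero).1 ?_
    have h1 : θc ^ 2 ≤ γ * L := by
      have := mul_le_mul_of_nonneg_left hμL hγ.le
      have : 0 < γ * μ * θc := by positivity
      linarith
    have h2 : (4 * τ : ℝ) ^ 2 ≤ ((τ : ℝ) ^ 2 + 3 * τ) ^ 2 := by
      refine pow_le_pow_left₀ (by positivity) ?_ 2
      nlinarith
    have h3 : θc ^ 2 * τ ^ 2 ≤ γ * L * τ ^ 2 := by gcongr
    have h4 := mul_le_mul_of_nonneg_left h2 hγL.le
    nlinarith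
  set p := q⁻¹ with hp
  have hp0 : 0 < p := inv_pos.2 hq0
  have hpq : p * q = 1 := inv_mul_cancel₀ hq0.ne'
  have hp2 (r : ℕ) (hr : r ≤ τ) : p ^ r ≤ 2 := by
    rw [hp, inv_pow, inv_le_comm₀ (by positivity) (by norm_num)]
    simpa using half_le_one_sub_pow hθ0.le hθ1 hθτ hr
  set D : ℕ → ℝ := fun k => ‖y k - w k‖ with hD
  set E : ℕ → ℝ := fun k => ‖x (k + 1) - y k‖ with hE
  have hy' (k : ℕ) : y k = x k + q • (x k - x (k - 1)) := by
    cases k with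
    | zero => rw [hy 0, ← hx0]; simp only [Nat.zero_sub]; module
    | succ k =>
      simp only [hy (k + 1), hθ, hx k, Nat.add_sub_cancel, hq]
      module
  have hDE (k : ℕ) :
      D k ≤ ∑ r ∈ Finset.range (k - j k), ((r : ℝ) + 2) * E (k - 1 - r) := by
    have hpred := norm_sub_momentum_prediction_le hq0.le (by linarith) hy' (j k) (k - j k)
    have hwk : w k = x (j k)
        + (∑ i ∈ Finset.range (k - j k + 1), q ^ (i + 1)) • (x (j k) - x (j k - 1)) := by
      rw [hw k]
      rcases Nat.eq_zero_or_pos (j k) with h0 | h0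
      · simp [h0]
      · have hc := momentum_coeff_eq hθ0.ne' (fun i hi => by simpa only [hθ] using ha i hi) hb h0
          (k - j k)
        rw [Nat.add_sub_of_le (hj k).2] at hc
        rw [hc]
    rwa [← hwk, Nat.add_sub_of_le (hj k).2] at hpred
  have hsum := sum_pow_mul_sq_delayed_le hp0.le hp2 (fun k => norm_nonneg (y k - w k))
    (n := fun k => k - j k) (fun k => by have := (hj k).1; omega) (fun k => Nat.sub_le _ _) hDE
  set V : ℕ → ℝ := fun k => f (x k) + h (x k) - (f xstar + h xstar)
    + (θc ^ 2 / (2 * γ) + μ * θc / 2) * ‖z k - xstar‖ ^ 2 with hV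
  have hcoef : θc ^ 2 / (2 * γ) = q * (θc ^ 2 / (2 * γ) + μ * θc / 2) := by
    rw [hq]
    field_simp
    linear_combination hroot
  have hVstep (k : ℕ) : V (k + 1) ≤ q * V k + (L * D k ^ 2 - (1 / (2 * γ) - L) * E k ^ 2) := by
    have := accelerated_prox_step_le hL.le hμ.le hγ hθ0.le hθ1 hf_conv hf_grad hf_lip hh_conv hh_sc
      xstar (hθ k ▸ hy k) (hθ k ▸ hz k) (hθ k ▸ hx k)
    rw [show θc ^ 2 / (2 * γ) * ‖z k - xstar‖ ^ 2
      = q * (θc ^ 2 / (2 * γ) + μ * θc / 2) * ‖z k - xstar‖ ^ 2 by rw [← hcoef]] at this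
    simp only [hV, hD, hE]
    linarith
  have htel (N : ℕ) : p ^ N * V N ≤ V 0 + (L * ∑ k ∈ Finset.range N, p ^ (k + 1) * D k ^ 2
      - (1 / (2 * γ) - L) * ∑ k ∈ Finset.range N, p ^ (k + 1) * E k ^ 2) := by
    induction N with
    | zero => simp
    | succ N ih =>
      rw [Finset.sum_range_succ, Finset.sum_range_succ]
      have h1 := mul_le_mul_of_nonneg_left (hVstep N) (pow_nonneg hp0.le (N + 1))
      have h2 : p ^ (N + 1) * (q * V N) = p ^ N * V N := by
        rw [pow_succ]; linear_combination p ^ N * V N * hpq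
      linarith
  intro K
  have hE0 : 0 ≤ ∑ k ∈ Finset.range (K + 1), p ^ (k + 1) * E k ^ 2 :=
    Finset.sum_nonneg fun k _ => by positivity
  have hLγ : L * (((τ : ℝ) ^ 2 + 3 * τ) ^ 2 / 2) ≤ 1 / (2 * γ) - L := by
    rw [le_sub_iff_add_le, le_div_iff₀ (by positivity)]
    linarith
  have hle : p ^ (K + 1) * V (K + 1) ≤ V 0 := by
    have h1 := mul_le_mul_of_nonneg_left (hsum (K + 1)) hL.le
    have h2 := mul_le_mul_of_nonneg_right hLγ hE0
    linarith [htel (K + 1)]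
  have hfin : V (K + 1) ≤ q ^ (K + 1) * V 0 := by
    have h1 := mul_le_mul_of_nonneg_left hle (pow_nonneg hq0.le (K + 1))
    rwa [← mul_assoc, ← mul_pow, mul_comm q p, hpq, one_pow, one_mul] at h1
  refine le_trans ?_ hfin
  simp only [hV]
  exact le_add_of_nonneg_right (by positivity)
end

section
/- For the asynchronous SVRG iteration with bounded delay and inconsistent coordinate reads, if the step size satisfies γ ≤ min{ (√5 − √2)·√2 / (20 · 5^{3/4} · √e · (√e − 1) · τ · L) , 1/(12 · √5 · e · (e − 1) · τ² · L) }, then for every epoch s ≥ 0: E( f(x̃^{s+1}) − f(x^*) ) ≤ ( f(x^0_0) − f(x^*) ) + (9/(16γm)) ‖x^0_0 − x^*‖². -/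
open scoped RealInnerProductSpace

/-- A convex function `f` with gradient field `g` that is Lipschitz with constant `L`. -/
structure IsConvexSmooth {E : Type*} [NormedAddCommGroup E] [InnerProductSpace ℝ E]
    [CompleteSpace E] (L : ℝ) (f : E → ℝ) (g : E → E) : Prop where
  convex : ConvexOn ℝ Set.univ f
  grad : ∀ u, HasGradientAt f (g u) u
  lip : ∀ u v, ‖g u - g v‖ ≤ L * ‖u - v‖

namespace IsConvexSmooth

variable {E : Type*} [NormedAddCommGroup E] [InnerProductSpace ℝ E] [CompleteSpace E]
  {L : ℝ} {f : E → ℝ} {g : E → E}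

lemma hasDerivAt_line (h : IsConvexSmooth L f g) (x w : E) (t : ℝ) :
    HasDerivAt (fun t : ℝ => f (x + t • w)) ⟪g (x + t • w), w⟫ t := by
  have h1 : HasDerivAt (fun t : ℝ => x + t • w) w t := by
    simpa using ((hasDerivAt_id t).smul_const w).const_add x
  have h2 := (h.grad (x + t • w)).hasFDerivAt.comp_hasDerivAt t h1
  rw [InnerProductSpace.toDual_apply_apply] at h2
  exact h2

lemma add_inner_le (h : IsConvexSmooth L f g) (x y : E) :
    f x + ⟪g x, y - x⟫ ≤ f y := by
  have hconv : ConvexOn ℝ Set.univ (fun t : ℝ => f (x + t • (y - x))) := by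
    have := h.convex.comp_affineMap (AffineMap.lineMap x y : ℝ →ᵃ[ℝ] E)
    simpa [Function.comp_def, AffineMap.lineMap_apply, add_comm] using this
  have hd := h.hasDerivAt_line x (y - x) 0
  have := hconv.le_slope_of_hasDerivAt (Set.mem_univ 0) (Set.mem_univ 1) one_pos hd
  simp [slope_def_field] at this
  linarith

lemma le_add_inner_add_sq (h : IsConvexSmooth L f g) (x y : E) :
    f y ≤ f x + ⟪g x, y - x⟫ + L / 2 * ‖y - x‖ ^ 2 := by
  set w := y - x with hw
  let ψ : ℝ → ℝ := fun t => f (x + t • w) - (t * ⟪g x, w⟫ + L / 2 * ‖w‖ ^ 2 * t ^ 2)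
  have hd : ∀ t, HasDerivAt ψ (⟪g (x + t • w), w⟫ - (⟪g x, w⟫ + L * ‖w‖ ^ 2 * t)) t := by
    intro t
    refine (h.hasDerivAt_line x w t).sub ?_
    refine (((hasDerivAt_id t).mul_const ⟪g x, w⟫).add
      ((hasDerivAt_pow 2 t).const_mul (L / 2 * ‖w‖ ^ 2))).congr_deriv ?_
    norm_num
    ring
  have hanti : AntitoneOn ψ (Set.Icc 0 1) := by
    refine antitoneOn_of_deriv_nonpos (convex_Icc 0 1)
      (fun t _ => (hd t).continuousAt.continuousWithinAt)
      (fun t _ => (hd t).differentiableAt.differentiableWithinAt) ?_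
    intro t ht
    rw [interior_Icc] at ht
    rw [(hd t).deriv]
    have h1 : ⟪g (x + t • w) - g x, w⟫ ≤ L * ‖w‖ ^ 2 * t := by
      calc ⟪g (x + t • w) - g x, w⟫ ≤ ‖g (x + t • w) - g x‖ * ‖w‖ := real_inner_le_norm _ _
        _ ≤ (L * ‖x + t • w - x‖) * ‖w‖ := by gcongr; exact h.lip _ _
        _ = L * ‖w‖ ^ 2 * t := by
          rw [add_sub_cancel_left, norm_smul, Real.norm_of_nonneg ht.1.le]; ring
    rw [inner_sub_left] at h1
    linarith
  have := hanti (Set.left_mem_Icc.2 zero_le_one) (Set.right_mem_Icc.2 zero_le_one) zero_le_one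
  simp [ψ, hw] at this
  rw [hw]
  linarith

lemma add_inner_add_sq_le (h : IsConvexSmooth L f g) (hL : 0 < L) (x y : E) :
    f x + ⟪g x, y - x⟫ + 1 / (2 * L) * ‖g y - g x‖ ^ 2 ≤ f y := by
  set w := g y - g x with hw
  have h1 := h.add_inner_le x (y - (1 / L) • w)
  have h2 := h.le_add_inner_add_sq y (y - (1 / L) • w)
  have e1 : y - (1 / L) • w - x = (y - x) - (1 / L) • w := by abel
  have e2 : y - (1 / L) • w - y = -((1 / L) • w) := by abel
  rw [e1, inner_sub_right, inner_smul_right] at h1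
  rw [e2, inner_neg_right, inner_smul_right, norm_neg, norm_smul, mul_pow,
    Real.norm_of_nonneg (by positivity)] at h2
  have h3 : ⟪g y, w⟫ - ⟪g x, w⟫ = ‖w‖ ^ 2 := by
    rw [← inner_sub_left, ← hw, real_inner_self_eq_norm_sq]
  have h4 : L / 2 * ((1 / L) ^ 2 * ‖w‖ ^ 2) = 1 / (2 * L) * ‖w‖ ^ 2 := by
    field_simp
  have h5 : 1 / L * ⟪g y, w⟫ = 1 / L * ⟪g x, w⟫ + 2 * (1 / (2 * L) * ‖w‖ ^ 2) := by
    rw [← h3]; field_simp; ring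
  linarith

lemma grad_eq_zero_of_isMin (h : IsConvexSmooth L f g) {z : E}
    (hz : ∀ u, f z ≤ f u) : g z = 0 := by
  have h1 : IsLocalMin f z := Filter.Eventually.of_forall hz
  have h2 := h1.hasFDerivAt_eq_zero (h.grad z).hasFDerivAt
  simpa using h2

lemma sub_le_sq_of_isMin (h : IsConvexSmooth L f g) {z : E}
    (hz : ∀ u, f z ≤ f u) (u : E) : f u - f z ≤ L / 2 * ‖u - z‖ ^ 2 := by
  have := h.le_add_inner_add_sq z u
  rw [h.grad_eq_zero_of_isMin hz, inner_zero_left] at this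
  linarith

lemma sq_grad_le_of_isMin (h : IsConvexSmooth L f g) (hL : 0 < L) {z : E}
    (hz : ∀ u, f z ≤ f u) (u : E) : ‖g u‖ ^ 2 ≤ 2 * L * (f u - f z) := by
  have := h.add_inner_add_sq_le hL z u
  rw [h.grad_eq_zero_of_isMin hz, inner_zero_left, sub_zero] at this
  have h2 : 2 * L * (1 / (2 * L) * ‖g u‖ ^ 2) ≤ 2 * L * (f u - f z) := by
    gcongr; linarith
  have h3 : 2 * L * (1 / (2 * L) * ‖g u‖ ^ 2) = ‖g u‖ ^ 2 := by field_simp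
  linarith

/-- The gradient evaluated at a perturbed point `y` still gives descent at `x`, up to the
squared size of the perturbation. -/
lemma sub_le_inner_perturbed (h : IsConvexSmooth L f g) (x y z : E) :
    f x - f z ≤ ⟪g y, x - z⟫ + L / 2 * ‖x - y‖ ^ 2 := by
  have h1 := h.add_inner_le y z
  have h2 := h.le_add_inner_add_sq y x
  have e : x - z = (x - y) - (z - y) := by abel
  rw [e, inner_sub_right]
  linarith

/-- The average of finitely many convex smooth functions is convex smooth. -/
lemma average {n : ℕ} (hn : 1 ≤ n) {fi : Fin n → E → ℝ} {fi' : Fin n → E → E}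
    (h : ∀ i, IsConvexSmooth L (fi i) (fi' i)) :
    IsConvexSmooth L (fun u => (1 / (n : ℝ)) * ∑ i, fi i u)
      (fun u => (1 / (n : ℝ)) • ∑ i, fi' i u) where
  convex := by
    refine ⟨convex_univ, fun x _ y _ a b ha hb hab => ?_⟩
    have : ∑ i, fi i (a • x + b • y) ≤ ∑ i, (a * fi i x + b * fi i y) :=
      Finset.sum_le_sum fun i _ => by
        simpa using (h i).convex.2 (Set.mem_univ x) (Set.mem_univ y) ha hb hab
    rw [Finset.sum_add_distrib, ← Finset.mul_sum, ← Finset.mul_sum] at this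
    have h2 := mul_le_mul_of_nonneg_left this (by positivity : 0 ≤ 1 / (n : ℝ))
    simp only [smul_eq_mul] at h2 ⊢
    linarith
  grad := by
    intro u
    rw [hasGradientAt_iff_hasFDerivAt, map_smul, map_sum]
    exact (HasFDerivAt.fun_sum fun i _ => ((h i).grad u).hasFDerivAt).const_mul _
  lip := by
    intro u v
    have hn0 : (0 : ℝ) < n := by exact_mod_cast hn
    rw [← smul_sub, ← Finset.sum_sub_distrib, norm_smul, Real.norm_of_nonneg (by positivity)]
    calc 1 / (n : ℝ) * ‖∑ i, (fi' i u - fi' i v)‖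
        ≤ 1 / (n : ℝ) * ∑ _i : Fin n, L * ‖u - v‖ := by
          gcongr
          exact norm_sum_le_of_le _ fun i _ => (h i).lip u v
      _ = L * ‖u - v‖ := by simp; field_simp

/-- Average of the squared gradient deviations from those at a minimizer of the average. -/
lemma sum_sq_grad_sub_le {n : ℕ} (hn : 1 ≤ n) (hL : 0 < L) {fi : Fin n → E → ℝ}
    {fi' : Fin n → E → E} (h : ∀ i, IsConvexSmooth L (fi i) (fi' i)) {z : E}
    (hz : ∀ u, (1 / (n : ℝ)) * ∑ i, fi i z ≤ (1 / (n : ℝ)) * ∑ i, fi i u) (u : E) :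
    ∑ i, ‖fi' i u - fi' i z‖ ^ 2 ≤
      n * (2 * L * ((1 / (n : ℝ)) * ∑ i, fi i u - (1 / (n : ℝ)) * ∑ i, fi i z)) := by
  have hn0 : (0 : ℝ) < n := by exact_mod_cast hn
  have h0 : ∑ i, fi' i z = 0 := by
    have := (average hn h).grad_eq_zero_of_isMin hz
    exact (smul_eq_zero.1 this).resolve_left (by positivity)
  have h1 : ∀ i, ‖fi' i u - fi' i z‖ ^ 2 ≤ 2 * L * (fi i u - fi i z - ⟪fi' i z, u - z⟫) := by
    intro i
    have := (h i).add_inner_add_sq_le hL z u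
    calc ‖fi' i u - fi' i z‖ ^ 2
        = 2 * L * (1 / (2 * L) * ‖fi' i u - fi' i z‖ ^ 2) := by field_simp
      _ ≤ _ := by gcongr; linarith
  calc ∑ i, ‖fi' i u - fi' i z‖ ^ 2
      ≤ ∑ i, 2 * L * (fi i u - fi i z - ⟪fi' i z, u - z⟫) := Finset.sum_le_sum fun i _ => h1 i
    _ = 2 * L * (∑ i, fi i u - ∑ i, fi i z) := by
      rw [← Finset.mul_sum, Finset.sum_sub_distrib, Finset.sum_sub_distrib, ← sum_inner, h0,
        inner_zero_left, sub_zero]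
    _ = _ := by field_simp

end IsConvexSmooth

/-- The variance-reduced gradient estimator of SVRG with snapshot `y`, evaluated at `u`. -/
noncomputable def svrgEstimator {E : Type*} [NormedAddCommGroup E] [InnerProductSpace ℝ E]
    {n : ℕ} (fi' : Fin n → E → E) (y u : E) (i : Fin n) : E :=
  fi' i u - fi' i y + (1 / (n : ℝ)) • ∑ j, fi' j y

lemma norm_add_sub_add_sq_le {E : Type*} [NormedAddCommGroup E] (a b c e : E) :
    ‖a + b - c + e‖ ^ 2 ≤ 4 * (‖a‖ ^ 2 + ‖b‖ ^ 2 + ‖c‖ ^ 2 + ‖e‖ ^ 2) := by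
  have h : ‖a + b - c + e‖ ≤ ‖a‖ + ‖b‖ + ‖c‖ + ‖e‖ :=
    (norm_add_le _ _).trans (by linarith [norm_sub_le (a + b) c, norm_add_le a b])
  calc ‖a + b - c + e‖ ^ 2 ≤ (‖a‖ + ‖b‖ + ‖c‖ + ‖e‖) ^ 2 := by gcongr
    _ ≤ _ := by
      linarith [sq_nonneg (‖a‖ - ‖b‖), sq_nonneg (‖a‖ - ‖c‖), sq_nonneg (‖a‖ - ‖e‖),
        sq_nonneg (‖b‖ - ‖c‖), sq_nonneg (‖b‖ - ‖e‖), sq_nonneg (‖c‖ - ‖e‖)]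

section Estimator

variable {E : Type*} [NormedAddCommGroup E] [InnerProductSpace ℝ E]

lemma sum_svrgEstimator {n : ℕ} (hn : 1 ≤ n) (fi' : Fin n → E → E) (y u : E) :
    ∑ i, svrgEstimator fi' y u i = ∑ i, fi' i u := by
  have hn0 : (n : ℝ) ≠ 0 := by positivity
  simp only [svrgEstimator, Finset.sum_add_distrib, Finset.sum_sub_distrib, Finset.sum_const,
    Finset.card_univ, Fintype.card_fin, ← Nat.cast_smul_eq_nsmul ℝ, smul_smul]
  rw [mul_one_div_cancel hn0, one_smul, sub_add_cancel]

variable [CompleteSpace E] {L : ℝ} {n : ℕ} {fi : Fin n → E → ℝ} {fi' : Fin n → E → E} {z : E}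

lemma sum_sq_svrgEstimator_le (hn : 1 ≤ n) (hL : 0 < L)
    (h : ∀ i, IsConvexSmooth L (fi i) (fi' i))
    (hz : ∀ u, (1 / (n : ℝ)) * ∑ i, fi i z ≤ (1 / (n : ℝ)) * ∑ i, fi i u) (x y u : E) :
    ∑ i, ‖svrgEstimator fi' y u i‖ ^ 2 ≤
      n * (4 * L ^ 2 * ‖x - u‖ ^ 2
        + 8 * L * ((1 / (n : ℝ)) * ∑ i, fi i x - (1 / (n : ℝ)) * ∑ i, fi i z)
        + 16 * L * ((1 / (n : ℝ)) * ∑ i, fi i y - (1 / (n : ℝ)) * ∑ i, fi i z)) := by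
  have hx := IsConvexSmooth.sum_sq_grad_sub_le hn hL h hz x
  have hy := IsConvexSmooth.sum_sq_grad_sub_le hn hL h hz y
  have hg := (IsConvexSmooth.average hn h).sq_grad_le_of_isMin hL hz y
  have hterm : ∀ i, ‖svrgEstimator fi' y u i‖ ^ 2 ≤
      4 * (L ^ 2 * ‖x - u‖ ^ 2 + ‖fi' i x - fi' i z‖ ^ 2 + ‖fi' i y - fi' i z‖ ^ 2
        + ‖(1 / (n : ℝ)) • ∑ j, fi' j y‖ ^ 2) := by
    intro i
    have e : svrgEstimator fi' y u i = (fi' i u - fi' i x) + (fi' i x - fi' i z)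
        - (fi' i y - fi' i z) + (1 / (n : ℝ)) • ∑ j, fi' j y := by
      rw [svrgEstimator]; abel
    have hl : ‖fi' i u - fi' i x‖ ^ 2 ≤ L ^ 2 * ‖x - u‖ ^ 2 := by
      rw [← mul_pow, norm_sub_rev x u]
      gcongr
      exact (h i).lip u x
    rw [e]
    refine (norm_add_sub_add_sq_le _ _ _ _).trans ?_
    gcongr
  calc ∑ i, ‖svrgEstimator fi' y u i‖ ^ 2 ≤ _ := Finset.sum_le_sum fun i _ => hterm i
    _ = 4 * (n * (L ^ 2 * ‖x - u‖ ^ 2) + ∑ i, ‖fi' i x - fi' i z‖ ^ 2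
        + ∑ i, ‖fi' i y - fi' i z‖ ^ 2 + n * ‖(1 / (n : ℝ)) • ∑ j, fi' j y‖ ^ 2) := by
      rw [← Finset.mul_sum]
      simp only [Finset.sum_add_distrib, Finset.sum_const, Finset.card_univ, Fintype.card_fin,
        nsmul_eq_mul]
    _ ≤ _ := by
      have := mul_le_mul_of_nonneg_left hg (Nat.cast_nonneg (α := ℝ) n)
      linarith

lemma sum_sq_svrg_step_le (hn : 1 ≤ n) (h : ∀ i, IsConvexSmooth L (fi i) (fi' i))
    {γ : ℝ} (hγ : 0 < γ) (x y u z : E) :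
    ∑ i, ‖x - γ • svrgEstimator fi' y u i - z‖ ^ 2 ≤
      n * (‖x - z‖ ^ 2 - 2 * γ * ((1 / (n : ℝ)) * ∑ i, fi i x - (1 / (n : ℝ)) * ∑ i, fi i z)
        + γ * L * ‖x - u‖ ^ 2) + γ ^ 2 * ∑ i, ‖svrgEstimator fi' y u i‖ ^ 2 := by
  have hn0 : (0 : ℝ) < n := by exact_mod_cast hn
  have hexp : ∀ i, ‖x - γ • svrgEstimator fi' y u i - z‖ ^ 2 =
      ‖x - z‖ ^ 2 - 2 * γ * ⟪svrgEstimator fi' y u i, x - z⟫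
        + γ ^ 2 * ‖svrgEstimator fi' y u i‖ ^ 2 := by
    intro i
    rw [sub_right_comm, norm_sub_sq_real, inner_smul_right, norm_smul, mul_pow,
      Real.norm_of_nonneg hγ.le, real_inner_comm]
    ring
  have hp := (IsConvexSmooth.average hn h).sub_le_inner_perturbed x u z
  rw [inner_smul_left] at hp
  simp only [RCLike.conj_to_real] at hp
  have hp2 := mul_le_mul_of_nonneg_left hp (by positivity : 0 ≤ 2 * γ * n)
  have e : 2 * γ * n * (1 / (n : ℝ) * ⟪∑ i, fi' i u, x - z⟫ + L / 2 * ‖x - u‖ ^ 2) =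
      2 * γ * ⟪∑ i, fi' i u, x - z⟫ + n * (γ * L * ‖x - u‖ ^ 2) := by
    field_simp
  rw [e] at hp2
  rw [Finset.sum_congr rfl fun i _ => hexp i, Finset.sum_add_distrib, Finset.sum_sub_distrib,
    ← Finset.mul_sum, ← Finset.mul_sum, ← sum_inner, sum_svrgEstimator hn]
  simp only [Finset.sum_const, Finset.card_univ, Fintype.card_fin, nsmul_eq_mul]
  linarith

end Estimator

lemma sum_range_sum_Ico_le (V : ℕ → ℝ) (hV : ∀ k, 0 ≤ V k) (m τ : ℕ) :
    ∑ k ∈ Finset.range m, ∑ l ∈ Finset.Ico (k - τ) k, V l ≤ τ * ∑ l ∈ Finset.range m, V l := by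
  have h1 : ∑ k ∈ Finset.range m, ∑ l ∈ Finset.Ico (k - τ) k, V l =
      ∑ l ∈ Finset.range m, ∑ _k ∈ (Finset.range m).filter (fun k => k - τ ≤ l ∧ l < k), V l := by
    refine Finset.sum_comm' fun k l => ?_
    simp only [Finset.mem_range, Finset.mem_Ico, Finset.mem_filter]
    omega
  rw [h1, Finset.mul_sum]
  refine Finset.sum_le_sum fun l _ => ?_
  rw [Finset.sum_const, nsmul_eq_mul]
  have h2 : ((Finset.range m).filter (fun k => k - τ ≤ l ∧ l < k)).card ≤ τ := by
    calc _ ≤ (Finset.Ioc l (l + τ)).card := by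
          refine Finset.card_le_card fun k hk => ?_
          simp only [Finset.mem_range, Finset.mem_filter, Finset.mem_Ioc] at hk ⊢
          omega
      _ = τ := by simp
  have h3 : (((Finset.range m).filter (fun k => k - τ ≤ l ∧ l < k)).card : ℝ) ≤ τ := by
    exact_mod_cast h2
  exact mul_le_mul_of_nonneg_right h3 (hV l)

lemma sq_sum_Ico_le (w : ℕ → ℝ) (k τ : ℕ) :
    (∑ l ∈ Finset.Ico (k - τ) k, w l) ^ 2 ≤ τ * ∑ l ∈ Finset.Ico (k - τ) k, w l ^ 2 := by
  refine sq_sum_le_card_mul_sum_sq.trans ?_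
  have h : (Finset.Ico (k - τ) k).card ≤ τ := by rw [Nat.card_Ico]; omega
  gcongr

/-- Inconsistent reads with delay at most `τ` are close to the current iterate. -/
lemma norm_sub_read_sq_le {d : ℕ} {γ : ℝ} {k τ : ℕ} {x xhat : EuclideanSpace ℝ (Fin d)}
    {v : ℕ → EuclideanSpace ℝ (Fin d)} {D : ℕ → Fin d → ℝ}
    (hD : ∀ l p, D l p = 0 ∨ D l p = 1)
    (hxhat : ∀ p, xhat p = x p + γ * ∑ l ∈ Finset.Ico (k - τ) k, D l p * v l p) :
    ‖x - xhat‖ ^ 2 ≤ γ ^ 2 * τ * ∑ l ∈ Finset.Ico (k - τ) k, ‖v l‖ ^ 2 := by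
  have hp : ∀ p, (x - xhat) p ^ 2 ≤ γ ^ 2 * τ * ∑ l ∈ Finset.Ico (k - τ) k, v l p ^ 2 := by
    intro p
    have e : (x - xhat) p ^ 2 = γ ^ 2 * (∑ l ∈ Finset.Ico (k - τ) k, D l p * v l p) ^ 2 := by
      rw [PiLp.sub_apply, hxhat p]; ring
    rw [e, mul_assoc]
    gcongr
    refine (sq_sum_Ico_le _ _ _).trans ?_
    refine mul_le_mul_of_nonneg_left (Finset.sum_le_sum fun l _ => ?_) (Nat.cast_nonneg τ)
    rcases hD l p with h | h <;> simp [h, sq_nonneg]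
  calc ‖x - xhat‖ ^ 2 = ∑ p, (x - xhat) p ^ 2 := EuclideanSpace.real_norm_sq_eq _
    _ ≤ ∑ p, γ ^ 2 * τ * ∑ l ∈ Finset.Ico (k - τ) k, v l p ^ 2 := Finset.sum_le_sum fun p _ => hp p
    _ = _ := by
      rw [← Finset.mul_sum, Finset.sum_comm]
      simp only [EuclideanSpace.real_norm_sq_eq]

/-- The numerical recursion behind one epoch of asynchronous SVRG: `X` are squared distances,
`F` function gaps, `V` squared update norms, `Δ` squared read errors, `T` the snapshot gap. -/
lemma delayed_descent_recursion {γ L T : ℝ} {m τ : ℕ} {X F V Δ : ℕ → ℝ}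
    (hγ : 0 < γ) (hL : 0 < L) (hτ : 1 ≤ τ) (hstep : 120 * (γ * L * (τ : ℝ) ^ 2) ≤ 1)
    (hX : ∀ k < m, X (k + 1) ≤ X k - 2 * γ * F k + γ * L * Δ k + γ ^ 2 * V k)
    (hV : ∀ k < m, V k ≤ 4 * L ^ 2 * Δ k + 8 * L * F k + 16 * L * T)
    (hΔ : ∀ k < m, Δ k ≤ γ ^ 2 * τ * ∑ l ∈ Finset.Ico (k - τ) k, V l)
    (hV0 : ∀ k, 0 ≤ V k) (hF0 : ∀ k, 0 ≤ F k) (hT0 : 0 ≤ T) :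
    X m + 16 * γ / 9 * ∑ k ∈ Finset.range m, F k ≤ X 0 + 16 * γ / 9 * (m * T) := by
  set SF := ∑ k ∈ Finset.range m, F k with hSF
  set SV := ∑ k ∈ Finset.range m, V k with hSV
  set SD := ∑ k ∈ Finset.range m, Δ k with hSD
  have hSF0 : 0 ≤ SF := Finset.sum_nonneg fun k _ => hF0 k
  have hSV0 : 0 ≤ SV := Finset.sum_nonneg fun k _ => hV0 k
  have hmT : 0 ≤ m * T := by positivity
  have hτ1 : (1 : ℝ) ≤ τ := by exact_mod_cast hτ
  have hD : SD ≤ γ ^ 2 * (τ : ℝ) ^ 2 * SV := by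
    calc SD ≤ ∑ k ∈ Finset.range m, γ ^ 2 * τ * ∑ l ∈ Finset.Ico (k - τ) k, V l :=
          Finset.sum_le_sum fun k hk => hΔ k (Finset.mem_range.1 hk)
      _ = γ ^ 2 * τ * ∑ k ∈ Finset.range m, ∑ l ∈ Finset.Ico (k - τ) k, V l := by
          rw [Finset.mul_sum]
      _ ≤ γ ^ 2 * τ * (τ * SV) := by gcongr; exact sum_range_sum_Ico_le V hV0 m τ
      _ = _ := by ring
  have hVs : SV ≤ 4 * L ^ 2 * SD + 8 * L * SF + 16 * L * (m * T) := by
    calc SV ≤ ∑ k ∈ Finset.range m, (4 * L ^ 2 * Δ k + 8 * L * F k + 16 * L * T) :=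
          Finset.sum_le_sum fun k hk => hV k (Finset.mem_range.1 hk)
      _ = _ := by
          simp only [Finset.sum_add_distrib, ← Finset.mul_sum, Finset.sum_const,
            Finset.card_range, nsmul_eq_mul]
          ring
  have hXs : X m - X 0 ≤ -(2 * γ * SF) + γ * L * SD + γ ^ 2 * SV := by
    rw [← Finset.sum_range_sub]
    calc _ ≤ ∑ k ∈ Finset.range m, (-(2 * γ * F k) + γ * L * Δ k + γ ^ 2 * V k) :=
          Finset.sum_le_sum fun k hk => by linarith [hX k (Finset.mem_range.1 hk)]
      _ = _ := by
          simp only [Finset.sum_add_distrib, Finset.sum_neg_distrib, ← Finset.mul_sum, hSF, hSV,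
            hSD]
  have hq : γ * L * (τ : ℝ) ^ 2 ≤ 1 / 120 := by linarith
  have hh : γ * L ≤ 1 / 120 := by
    refine le_trans ?_ hq
    exact le_mul_of_one_le_right (by positivity) (one_le_pow₀ hτ1)
  have hLD : 4 * L ^ 2 * SD ≤ 1 / 3600 * SV := by
    calc 4 * L ^ 2 * SD ≤ 4 * L ^ 2 * (γ ^ 2 * (τ : ℝ) ^ 2 * SV) := by gcongr
      _ = 4 * ((γ * L) * (γ * L * (τ : ℝ) ^ 2)) * SV := by ring
      _ ≤ 4 * ((1 / 120) * (1 / 120)) * SV := by gcongr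
      _ = _ := by ring
  have hVb : SV ≤ 9 * L * (SF + 2 * (m * T)) := by
    have : 0 ≤ L * (SF + 2 * (m * T)) := by positivity
    linarith
  have hgD : γ * L * SD ≤ γ ^ 2 * (1 / 120 * SV) := by
    calc γ * L * SD ≤ γ * L * (γ ^ 2 * (τ : ℝ) ^ 2 * SV) := by gcongr
      _ = γ ^ 2 * ((γ * L * (τ : ℝ) ^ 2) * SV) := by ring
      _ ≤ _ := by gcongr
  have hgV : γ ^ 2 * SV ≤ γ * (9 / 120 * (SF + 2 * (m * T))) := by
    calc γ ^ 2 * SV ≤ γ ^ 2 * (9 * L * (SF + 2 * (m * T))) := by gcongr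
      _ = γ * (9 * (γ * L) * (SF + 2 * (m * T))) := by ring
      _ ≤ γ * (9 * (1 / 120) * (SF + 2 * (m * T))) := by gcongr
      _ = _ := by ring
  have h1 : 0 ≤ γ * SF := by positivity
  have h2 : 0 ≤ γ * (m * T) := by positivity
  linarith

/-- One epoch of asynchronous SVRG, summed over a finite sample space `Ω`. The hypothesis `hres`
says that the index drawn at step `k` is uniform and independent of the state at step `k`. -/
lemma asvrg_epoch_descent {E Ω : Type*} [NormedAddCommGroup E] [InnerProductSpace ℝ E]
    [CompleteSpace E] [Fintype Ω] {L γ : ℝ} {n m τ : ℕ} {fi : Fin n → E → ℝ}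
    {fi' : Fin n → E → E} {z : E} (hn : 1 ≤ n) (hL : 0 < L) (hγ : 0 < γ) (hτ : 1 ≤ τ)
    (hstep : 120 * (γ * L * (τ : ℝ) ^ 2) ≤ 1) (h : ∀ i, IsConvexSmooth L (fi i) (fi' i))
    (hz : ∀ u, (1 / (n : ℝ)) * ∑ i, fi i z ≤ (1 / (n : ℝ)) * ∑ i, fi i u)
    {x v xhat : Ω → ℕ → E} {y : Ω → E} {idx : Ω → ℕ → Fin n}
    (hres : ∀ k < m, ∀ G : E → E → E → Fin n → ℝ,
      n * ∑ ω, G (x ω k) (y ω) (xhat ω k) (idx ω k) =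
        ∑ ω, ∑ i, G (x ω k) (y ω) (xhat ω k) i)
    (hv : ∀ ω, ∀ k < m, v ω k = svrgEstimator fi' (y ω) (xhat ω k) (idx ω k))
    (hupd : ∀ ω, ∀ k < m, x ω (k + 1) = x ω k - γ • v ω k)
    (hdelay : ∀ ω, ∀ k < m,
      ‖x ω k - xhat ω k‖ ^ 2 ≤ γ ^ 2 * τ * ∑ l ∈ Finset.Ico (k - τ) k, ‖v ω l‖ ^ 2) :
    ∑ ω, ‖x ω m - z‖ ^ 2 + 16 * γ / 9 * ∑ k ∈ Finset.range m, ∑ ω,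
        ((1 / (n : ℝ)) * ∑ i, fi i (x ω k) - (1 / (n : ℝ)) * ∑ i, fi i z) ≤
      ∑ ω, ‖x ω 0 - z‖ ^ 2 + 16 * γ / 9 * (m * ∑ ω,
        ((1 / (n : ℝ)) * ∑ i, fi i (y ω) - (1 / (n : ℝ)) * ∑ i, fi i z)) := by
  have hn0 : (0 : ℝ) < n := by exact_mod_cast hn
  have hVres : ∀ k < m, n * ∑ ω, ‖v ω k‖ ^ 2 =
      ∑ ω, ∑ i, ‖svrgEstimator fi' (y ω) (xhat ω k) i‖ ^ 2 := by
    intro k hk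
    rw [← hres k hk fun _ y u i => ‖svrgEstimator fi' y u i‖ ^ 2]
    simp only [hv _ k hk]
  refine delayed_descent_recursion (X := fun k => ∑ ω, ‖x ω k - z‖ ^ 2)
    (V := fun k => ∑ ω, ‖v ω k‖ ^ 2) (Δ := fun k => ∑ ω, ‖x ω k - xhat ω k‖ ^ 2)
    hγ hL hτ hstep ?_ ?_ ?_ ?_ ?_ ?_
  · intro k hk
    refine le_of_mul_le_mul_left ?_ hn0
    calc n * ∑ ω, ‖x ω (k + 1) - z‖ ^ 2
        = ∑ ω, ∑ i, ‖x ω k - γ • svrgEstimator fi' (y ω) (xhat ω k) i - z‖ ^ 2 := by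
          rw [← hres k hk fun x y u i => ‖x - γ • svrgEstimator fi' y u i - z‖ ^ 2]
          simp only [hupd _ k hk, hv _ k hk]
      _ ≤ _ := Finset.sum_le_sum fun ω _ =>
          sum_sq_svrg_step_le hn h hγ (x ω k) (y ω) (xhat ω k) z
      _ = _ := by
          rw [Finset.sum_add_distrib, ← Finset.mul_sum, ← Finset.mul_sum, ← hVres k hk,
            Finset.sum_add_distrib, Finset.sum_sub_distrib, ← Finset.mul_sum, ← Finset.mul_sum]
          ring
  · intro k hk
    refine le_of_mul_le_mul_left ?_ hn0
    rw [hVres k hk]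
    refine (Finset.sum_le_sum fun ω _ =>
      sum_sq_svrgEstimator_le hn hL h hz (x ω k) (y ω) (xhat ω k)).trans_eq ?_
    rw [← Finset.mul_sum, Finset.sum_add_distrib, Finset.sum_add_distrib, ← Finset.mul_sum,
      ← Finset.mul_sum, ← Finset.mul_sum]
  · intro k hk
    refine (Finset.sum_le_sum fun ω _ => hdelay ω k hk).trans_eq ?_
    rw [← Finset.mul_sum, Finset.sum_comm]
  · exact fun k => Finset.sum_nonneg fun ω _ => by positivity
  · exact fun k => Finset.sum_nonneg fun ω _ => sub_nonneg.2 (hz _)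
  · exact Finset.sum_nonneg fun ω _ => sub_nonneg.2 (hz _)

/-- Jensen's inequality for the average `y` of the iterates `x 1, …, x m`. -/
lemma ConvexOn.sub_le_of_average {E : Type*} [AddCommGroup E] [Module ℝ E] {f : E → ℝ}
    (hf : ConvexOn ℝ Set.univ f) {m : ℕ} (hm : 1 ≤ m) {x : ℕ → E} {y : E} (c : ℝ)
    (hy : y = (1 / (m : ℝ)) • ∑ k ∈ Finset.Icc 1 m, x k) :
    m * (f y - c) ≤ ∑ k ∈ Finset.range m, (f (x k) - c) + (f (x m) - c) - (f (x 0) - c) := by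
  have hm0 : (0 : ℝ) < m := by exact_mod_cast hm
  have h1 : f y ≤ ∑ k ∈ Finset.Icc 1 m, (1 / (m : ℝ)) * f (x k) := by
    rw [hy, Finset.smul_sum]
    refine hf.map_sum_le (fun _ _ => by positivity) ?_ fun _ _ => Set.mem_univ _
    simp only [Finset.sum_const, Nat.card_Icc, nsmul_eq_mul, add_tsub_cancel_right]
    exact mul_one_div_cancel hm0.ne'
  rw [← Finset.mul_sum] at h1
  have h2 : ∑ k ∈ Finset.Icc 1 m, f (x k) = ∑ k ∈ Finset.range m, f (x (k + 1)) := by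
    rw [Finset.range_eq_Ico, Finset.sum_Ico_add' (fun k => f (x k)) 0 m 1]
    rfl
  have h3 := Finset.sum_range_succ (fun k => f (x k)) m
  rw [Finset.sum_range_succ'] at h3
  have h4 : (m : ℝ) * f y ≤ ∑ k ∈ Finset.Icc 1 m, f (x k) := by
    calc (m : ℝ) * f y ≤ m * (1 / (m : ℝ) * ∑ k ∈ Finset.Icc 1 m, f (x k)) := by gcongr
      _ = _ := by field_simp
  simp only [Finset.sum_sub_distrib, Finset.sum_const, Finset.card_range, nsmul_eq_mul]
  linarith

/-- Averaging over arrays of indices: if `g` does not depend on the entry `(s, k)` of the array,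
that entry may be replaced by an independent uniform index. -/
lemma card_mul_sum_entry {A B C : Type*} [Fintype A] [Fintype B] [Fintype C] [DecidableEq A]
    [DecidableEq B] (s : A) (k : B) (g : (A → B → C) → C → ℝ)
    (hg : ∀ ω c i, g (Function.update ω s (Function.update (ω s) k c)) i = g ω i) :
    Fintype.card C * ∑ ω, g ω (ω s k) = ∑ ω, ∑ i, g ω i := by
  have hinv : Function.Involutive fun q : (A → B → C) × C =>
      (Function.update q.1 s (Function.update (q.1 s) k q.2), q.1 s k) := by
    rintro ⟨ω, c⟩
    simp
  calc Fintype.card C * ∑ ω, g ω (ω s k)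
      = ∑ q : (A → B → C) × C, g q.1 (q.1 s k) := by
        rw [Fintype.sum_prod_type, Finset.mul_sum]
        simp
    _ = ∑ q : (A → B → C) × C, g q.1 q.2 := by
        rw [← Equiv.sum_comp hinv.toPerm]
        refine Finset.sum_congr rfl fun q _ => ?_
        simp [hg]
    _ = _ := Fintype.sum_prod_type _

/-- Two index arrays agree on all entries drawn before inner iteration `k` of epoch `s`. -/
def AgreeBefore {a b : ℕ} {C : Type*} (ω ω' : Fin a → Fin b → C) (s k : ℕ) : Prop :=
  ∀ (s' : Fin a) (k' : Fin b), ((s' : ℕ) < s ∨ ((s' : ℕ) = s ∧ (k' : ℕ) < k)) →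
    ω s' k' = ω' s' k'

lemma AgreeBefore.mono {a b : ℕ} {C : Type*} {ω ω' : Fin a → Fin b → C} {s k s₁ k₁ : ℕ}
    (h : AgreeBefore ω ω' s k) (hle : s₁ < s ∨ s₁ = s ∧ k₁ ≤ k) : AgreeBefore ω ω' s₁ k₁ :=
  fun s' k' h' => h s' k' (by omega)

lemma agreeBefore_update {a b : ℕ} {C : Type*} (ω : Fin a → Fin b → C) (s : Fin a) (k : Fin b)
    (c : C) :
    AgreeBefore (Function.update ω s (Function.update (ω s) k c)) ω s k := by
  intro s' k' h
  by_cases hs : s' = s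
  · subst hs
    have hk : k' ≠ k := by
      rintro rfl
      omega
    simp [hk]
  · simp [hs]

/-- The state of asynchronous SVRG at inner iteration `k` of epoch `s` depends only on the indices
drawn before. -/
lemma asvrg_state_eq_of_agreeBefore
    {d n S τ : ℕ} {fi' : Fin n → EuclideanSpace ℝ (Fin d) → EuclideanSpace ℝ (Fin d)} {γ : ℝ}
    {x v xhat : (Fin (S + 1) → Fin (2 * n) → Fin n) → ℕ → ℕ → EuclideanSpace ℝ (Fin d)}
    {xt : (Fin (S + 1) → Fin (2 * n) → Fin n) → ℕ → EuclideanSpace ℝ (Fin d)}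
    {D : (Fin (S + 1) → Fin (2 * n) → Fin n) → ℕ → ℕ → ℕ → Fin d → ℝ}
    {x0 : EuclideanSpace ℝ (Fin d)}
    (hx00 : ∀ ω, x ω 0 0 = x0) (hxt0 : ∀ ω, xt ω 0 = x0)
    (hDadapt : ∀ ω ω' s k l p, AgreeBefore ω ω' s k → D ω s k l p = D ω' s k l p)
    (hv : ∀ ω s, ∀ hs : s < S + 1, ∀ k, ∀ hk : k < 2 * n,
      v ω s k = svrgEstimator fi' (xt ω s) (xhat ω s k) (ω ⟨s, hs⟩ ⟨k, hk⟩))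
    (hxhat : ∀ ω s k, s < S + 1 → k < 2 * n → ∀ p : Fin d,
      xhat ω s k p = x ω s k p
        + γ * ∑ l ∈ Finset.Ico (k - τ) k, D ω s k l p * v ω s l p)
    (hxupd : ∀ ω s k, s < S + 1 → k < 2 * n → x ω s (k + 1) = x ω s k - γ • v ω s k)
    (hchain : ∀ ω s, s < S → x ω (s + 1) 0 = x ω s (2 * n))
    (hsnap : ∀ ω s, s < S + 1 →
      xt ω (s + 1) = (1 / (2 * (n : ℝ))) • ∑ k ∈ Finset.Icc 1 (2 * n), x ω s k)
    {s k : ℕ} (hs : s < S + 1) (hk : k < 2 * n)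
    {ω ω' : Fin (S + 1) → Fin (2 * n) → Fin n} (h : AgreeBefore ω ω' s k) :
    x ω s k = x ω' s k ∧ xt ω s = xt ω' s ∧ xhat ω s k = xhat ω' s k := by
  have hread : ∀ s < S + 1, ∀ k < 2 * n, ∀ ω ω', AgreeBefore ω ω' s k →
      x ω s k = x ω' s k → (∀ l < k, v ω s l = v ω' s l) → xhat ω s k = xhat ω' s k := by
    intro s hs k hk ω ω' h hx hvl
    ext p
    rw [hxhat ω s k hs hk, hxhat ω' s k hs hk, hx]
    congr 2
    refine Finset.sum_congr rfl fun l hl => ?_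
    rw [hDadapt ω ω' s k l p h, hvl l (Finset.mem_Ico.1 hl).2]
  have hinner : ∀ s < S + 1,
      (∀ ω ω', AgreeBefore ω ω' s 0 → x ω s 0 = x ω' s 0 ∧ xt ω s = xt ω' s) →
      ∀ k ≤ 2 * n, ∀ ω ω', AgreeBefore ω ω' s k →
        x ω s k = x ω' s k ∧ ∀ l < k, v ω s l = v ω' s l := by
    intro s hs h0 k
    induction k with
    | zero => exact fun _ ω ω' h => ⟨(h0 ω ω' h).1, fun l hl => absurd hl (Nat.not_lt_zero l)⟩
    | succ k ih =>
      intro hk ω ω' h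
      have hk' : k < 2 * n := hk
      have hprev : AgreeBefore ω ω' s k := h.mono (Or.inr ⟨rfl, k.le_succ⟩)
      obtain ⟨hx, hvl⟩ := ih hk'.le ω ω' hprev
      have hvk : v ω s k = v ω' s k := by
        rw [hv ω s hs k hk', hv ω' s hs k hk', hread s hs k hk' ω ω' hprev hx hvl,
          (h0 ω ω' (h.mono (Or.inr ⟨rfl, Nat.zero_le _⟩))).2,
          h ⟨s, hs⟩ ⟨k, hk'⟩ (Or.inr ⟨rfl, k.lt_succ_self⟩)]
      refine ⟨by rw [hxupd ω s k hs hk', hxupd ω' s k hs hk', hx, hvk], fun l hl => ?_⟩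
      rcases Nat.lt_succ_iff_lt_or_eq.1 hl with hl | rfl
      · exact hvl l hl
      · exact hvk
  have hstart : ∀ s < S + 1, ∀ ω ω', AgreeBefore ω ω' s 0 →
      x ω s 0 = x ω' s 0 ∧ xt ω s = xt ω' s := by
    intro s
    induction s with
    | zero => exact fun _ ω ω' _ => ⟨by rw [hx00, hx00], by rw [hxt0, hxt0]⟩
    | succ s ih =>
      intro hs ω ω' h
      have hs' : s < S + 1 := (Nat.lt_succ_self s).trans hs
      have hx : ∀ k ≤ 2 * n, x ω s k = x ω' s k := fun k hk =>
        (hinner s hs' (ih hs') k hk ω ω' (h.mono (Or.inl s.lt_succ_self))).1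
      refine ⟨?_, ?_⟩
      · rw [hchain ω s (by omega), hchain ω' s (by omega), hx _ le_rfl]
      · rw [hsnap ω s hs', hsnap ω' s hs']
        congr 1
        exact Finset.sum_congr rfl fun k hk => hx k (Finset.mem_Icc.1 hk).2
  obtain ⟨hx, hvl⟩ := hinner s hs (hstart s hs) k hk.le ω ω' h
  exact ⟨hx, (hstart s hs ω ω' (h.mono (Or.inr ⟨rfl, Nat.zero_le _⟩))).2,
    hread s hs k hk ω ω' h hx hvl⟩

/-- Numerical form of the step-size restriction. -/
lemma mul_le_one_of_le_step_bound {γ L τ : ℝ} (hL : 0 < L) (hτ : 0 < τ) (hγ : 0 < γ)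
    (h : γ ≤ 1 / (12 * Real.sqrt 5 * Real.exp 1 * (Real.exp 1 - 1) * τ ^ 2 * L)) :
    120 * (γ * L * τ ^ 2) ≤ 1 := by
  have h5 : (2.2 : ℝ) ≤ Real.sqrt 5 := Real.le_sqrt_of_sq_le (by norm_num)
  have he : (2.7 : ℝ) ≤ Real.exp 1 := by linarith [Real.exp_one_gt_d9]
  have hC : 120 ≤ 12 * Real.sqrt 5 * Real.exp 1 * (Real.exp 1 - 1) := by
    calc (120 : ℝ) ≤ 12 * 2.2 * 2.7 * (2.7 - 1) := by norm_num
      _ ≤ _ := by gcongr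
  rw [le_div_iff₀ (by positivity)] at h
  have := mul_le_mul_of_nonneg_right hC (by positivity : 0 ≤ γ * L * τ ^ 2)
  linarith

/-- Asynchronous SVRG with bounded delay and inconsistent (wild) coordinate reads:
sublinear convergence of the snapshots for epoch length `m = 2n`, under the stated
step-size bound. The epoch `S` in the conclusion is arbitrary, and randomness is modelled
by averaging over all index arrays `ω : Fin (S+1) → Fin (2n) → Fin n`. -/
theorem asvrg_wild_convergence
    (d n : ℕ) (hn : 1 ≤ n)
    (fi : Fin n → EuclideanSpace ℝ (Fin d) → ℝ)
    (fi' : Fin n → EuclideanSpace ℝ (Fin d) → EuclideanSpace ℝ (Fin d))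
    (L : ℝ) (hL : 0 < L)
    (hfi_conv : ∀ i, ConvexOn ℝ Set.univ (fi i))
    (hfi_grad : ∀ i u, HasGradientAt (fi i) (fi' i u) u)
    (hfi_lip : ∀ i u v, ‖fi' i u - fi' i v‖ ≤ L * ‖u - v‖)
    (xstar : EuclideanSpace ℝ (Fin d))
    (hmin : ∀ u, (1 / (n : ℝ)) * ∑ i, fi i xstar ≤ (1 / (n : ℝ)) * ∑ i, fi i u)
    (γ : ℝ) (hγ : 0 < γ)
    (τ : ℕ) (hτ : 1 ≤ τ)
    (S : ℕ)
    (x v xhat : (Fin (S + 1) → Fin (2 * n) → Fin n) → ℕ → ℕ → EuclideanSpace ℝ (Fin d))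
    (xt : (Fin (S + 1) → Fin (2 * n) → Fin n) → ℕ → EuclideanSpace ℝ (Fin d))
    (D : (Fin (S + 1) → Fin (2 * n) → Fin n) → ℕ → ℕ → ℕ → Fin d → ℝ)
    (x0 : EuclideanSpace ℝ (Fin d))
    (hx00 : ∀ ω, x ω 0 0 = x0) (hxt0 : ∀ ω, xt ω 0 = x0)
    (hD01 : ∀ ω s k l p, D ω s k l p = 0 ∨ D ω s k l p = 1)
    (hDadapt : ∀ ω ω' s k l p,
      (∀ (s' : Fin (S + 1)) (k' : Fin (2 * n)),
          ((s' : ℕ) < s ∨ ((s' : ℕ) = s ∧ (k' : ℕ) < k)) → ω s' k' = ω' s' k') →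
        D ω s k l p = D ω' s k l p)
    (hv : ∀ ω s, ∀ hs : s < S + 1, ∀ k, ∀ hk : k < 2 * n,
      v ω s k = fi' (ω ⟨s, hs⟩ ⟨k, hk⟩) (xhat ω s k)
        - fi' (ω ⟨s, hs⟩ ⟨k, hk⟩) (xt ω s)
        + (1 / (n : ℝ)) • ∑ i, fi' i (xt ω s))
    (hxhat : ∀ ω s k, s < S + 1 → k < 2 * n → ∀ p : Fin d,
      xhat ω s k p = x ω s k p
        + γ * ∑ l ∈ Finset.Ico (k - τ) k, D ω s k l p * v ω s l p)
    (hxupd : ∀ ω s k, s < S + 1 → k < 2 * n →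
      x ω s (k + 1) = x ω s k - γ • v ω s k)
    (hchain : ∀ ω s, s < S → x ω (s + 1) 0 = x ω s (2 * n))
    (hsnap : ∀ ω s, s < S + 1 →
      xt ω (s + 1) = (1 / (2 * (n : ℝ))) • ∑ k ∈ Finset.Icc 1 (2 * n), x ω s k)
    (hstep : γ ≤ min
        ((Real.sqrt 5 - Real.sqrt 2) * Real.sqrt 2
          / (20 * (5 : ℝ) ^ ((3 : ℝ) / 4) * Real.sqrt (Real.exp 1)
              * (Real.sqrt (Real.exp 1) - 1) * τ * L))
        (1 / (12 * Real.sqrt 5 * Real.exp 1 * (Real.exp 1 - 1) * (τ : ℝ) ^ 2 * L))) :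
    (∑ ω : Fin (S + 1) → Fin (2 * n) → Fin n,
          (1 / (n : ℝ)) * ∑ i, fi i (xt ω (S + 1)))
        / (Fintype.card (Fin (S + 1) → Fin (2 * n) → Fin n) : ℝ)
      - (1 / (n : ℝ)) * ∑ i, fi i xstar
    ≤ ((1 / (n : ℝ)) * ∑ i, fi i x0 - (1 / (n : ℝ)) * ∑ i, fi i xstar)
      + 9 / (16 * γ * (2 * (n : ℝ))) * ‖x0 - xstar‖ ^ 2 := by
  have hn0 : (0 : ℝ) < n := by exact_mod_cast hn
  have hτ1 : (1 : ℝ) ≤ τ := by exact_mod_cast hτ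
  have hcs : ∀ i, IsConvexSmooth L (fi i) (fi' i) := fun i =>
    ⟨hfi_conv i, hfi_grad i, hfi_lip i⟩
  have hstep' : 120 * (γ * L * (τ : ℝ) ^ 2) ≤ 1 :=
    mul_le_one_of_le_step_bound hL (by positivity) hγ (hstep.trans (min_le_right _ _))
  have hγL : 120 * (γ * L) ≤ 1 := by
    have := le_mul_of_one_le_right (by positivity : 0 ≤ γ * L) (one_le_pow₀ hτ1 (n := 2))
    linarith
  set f : EuclideanSpace ℝ (Fin d) → ℝ := fun u => (1 / (n : ℝ)) * ∑ i, fi i u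
  have havg : IsConvexSmooth L f (fun u => (1 / (n : ℝ)) • ∑ i, fi' i u) :=
    IsConvexSmooth.average hn hcs
  have hres : ∀ s, ∀ hs : s < S + 1, ∀ k, ∀ hk : k < 2 * n,
      ∀ G : EuclideanSpace ℝ (Fin d) → EuclideanSpace ℝ (Fin d) → EuclideanSpace ℝ (Fin d) →
        Fin n → ℝ,
      n * ∑ ω, G (x ω s k) (xt ω s) (xhat ω s k) (ω ⟨s, hs⟩ ⟨k, hk⟩) =
        ∑ ω, ∑ i, G (x ω s k) (xt ω s) (xhat ω s k) i := by
    intro s hs k hk G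
    have := card_mul_sum_entry (⟨s, hs⟩ : Fin (S + 1)) (⟨k, hk⟩ : Fin (2 * n))
      (fun ω i => G (x ω s k) (xt ω s) (xhat ω s k) i) ?_
    · rwa [Fintype.card_fin] at this
    · intro ω c i
      obtain ⟨h1, h2, h3⟩ := asvrg_state_eq_of_agreeBefore hx00 hxt0 hDadapt hv hxhat hxupd hchain
        hsnap hs hk (agreeBefore_update ω ⟨s, hs⟩ ⟨k, hk⟩ c)
      simp only [h1, h2, h3]
  have hepoch : ∀ s < S + 1,
      ∑ ω, (2 * n * (f (xt ω (s + 1)) - f xstar) - (f (x ω s (2 * n)) - f xstar)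
        + 9 / (16 * γ) * ‖x ω s (2 * n) - xstar‖ ^ 2) ≤
      ∑ ω, (2 * n * (f (xt ω s) - f xstar) - (f (x ω s 0) - f xstar)
        + 9 / (16 * γ) * ‖x ω s 0 - xstar‖ ^ 2) := by
    intro s hs
    have h1 : ∑ ω, ‖x ω s (2 * n) - xstar‖ ^ 2 + 16 * γ / 9 *
          ∑ k ∈ Finset.range (2 * n), ∑ ω, (f (x ω s k) - f xstar) ≤
        ∑ ω, ‖x ω s 0 - xstar‖ ^ 2 + 16 * γ / 9 *
          ((2 * n : ℕ) * ∑ ω, (f (xt ω s) - f xstar)) :=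
      asvrg_epoch_descent (m := 2 * n) (z := xstar) (x := fun ω k => x ω s k)
      (v := fun ω k => v ω s k) (xhat := fun ω k => xhat ω s k) (y := fun ω => xt ω s)
      (idx := fun ω k => if hk : k < 2 * n then ω ⟨s, hs⟩ ⟨k, hk⟩ else ⟨0, hn⟩)
      hn hL hγ hτ hstep' hcs hmin
      (fun k hk G => by simpa only [dif_pos hk] using hres s hs k hk G)
      (fun ω k hk => by rw [dif_pos hk]; exact hv ω s hs k hk)
      (fun ω k hk => hxupd ω s k hs hk)
      (fun ω k hk => norm_sub_read_sq_le (hD01 ω s k) (hxhat ω s k hs hk))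
    have h2 : ∑ ω, 2 * n * (f (xt ω (s + 1)) - f xstar) ≤
        ∑ ω, (∑ k ∈ Finset.range (2 * n), (f (x ω s k) - f xstar)
          + (f (x ω s (2 * n)) - f xstar) - (f (x ω s 0) - f xstar)) := by
      refine Finset.sum_le_sum fun ω _ => ?_
      have := havg.convex.sub_le_of_average (m := 2 * n) (by omega) (x := fun k => x ω s k)
        (f xstar) (y := xt ω (s + 1)) (by push_cast; exact hsnap ω s hs)
      push_cast at this
      exact this
    have h3 := mul_le_mul_of_nonneg_left h1 (by positivity : 0 ≤ 9 / (16 * γ))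
    have e : ∀ A B : ℝ, 9 / (16 * γ) * (A + 16 * γ / 9 * B) = 9 / (16 * γ) * A + B := by
      intro A B
      field_simp
    rw [e, e, Finset.sum_comm] at h3
    push_cast at h3
    simp only [Finset.sum_add_distrib, Finset.sum_sub_distrib, ← Finset.mul_sum] at h2 h3 ⊢
    linarith
  have hpot : ∀ s < S + 1,
      ∑ ω, (2 * n * (f (xt ω s) - f xstar) - (f (x ω s 0) - f xstar)
        + 9 / (16 * γ) * ‖x ω s 0 - xstar‖ ^ 2) ≤
      ∑ _ω : Fin (S + 1) → Fin (2 * n) → Fin n,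
        (2 * n * (f x0 - f xstar) + 9 / (16 * γ) * ‖x0 - xstar‖ ^ 2) := by
    intro s
    induction s with
    | zero =>
      intro _
      refine Finset.sum_le_sum fun ω _ => ?_
      rw [hx00, hxt0]
      linarith [hmin x0]
    | succ s ih =>
      intro hs
      have hs' : s < S + 1 := by omega
      refine le_trans ?_ ((hepoch s hs').trans (ih hs'))
      simp only [hchain _ s (Nat.lt_of_succ_lt_succ hs)]
      exact le_rfl
  have hlast : ∑ ω, 2 * n * (f (xt ω (S + 1)) - f xstar) ≤
      ∑ _ω : Fin (S + 1) → Fin (2 * n) → Fin n,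
        (2 * n * (f x0 - f xstar) + 9 / (16 * γ) * ‖x0 - xstar‖ ^ 2) := by
    refine le_trans (Finset.sum_le_sum fun ω _ => ?_)
      ((hepoch S S.lt_succ_self).trans (hpot S S.lt_succ_self))
    have h1 := havg.sub_le_sq_of_isMin hmin (x ω S (2 * n))
    have h2 : L / 2 ≤ 9 / (16 * γ) := by
      rw [div_le_div_iff₀ two_pos (by positivity)]
      linarith
    have h3 := mul_le_mul_of_nonneg_right h2 (sq_nonneg ‖x ω S (2 * n) - xstar‖)
    linarith
  have hcard : (0 : ℝ) < Fintype.card (Fin (S + 1) → Fin (2 * n) → Fin n) := by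
    have : Nonempty (Fin n) := ⟨⟨0, hn⟩⟩
    exact_mod_cast Fintype.card_pos
  rw [← Finset.mul_sum, Finset.sum_sub_distrib] at hlast
  simp only [Finset.sum_const, Finset.card_univ, nsmul_eq_mul] at hlast
  rw [sub_le_iff_le_add, div_le_iff₀ hcard]
  refine le_of_mul_le_mul_left ?_ (by positivity : (0 : ℝ) < 2 * n)
  have e : 2 * (n : ℝ) * (9 / (16 * γ * (2 * n)) * ‖x0 - xstar‖ ^ 2) =
      9 / (16 * γ) * ‖x0 - xstar‖ ^ 2 := by
    field_simp
  rw [← e] at hlast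
  linarith
end
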